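/- arXiv:1911.08875 — 3 statements merged into one kernel-verified Lean document; each statement's English description precedes it below -/
import Mathlib

section
/- Fix a noise level ε ∈ [0,1) and a target risk level q̄ ∈ (0,1] such that t* := 1/q̄ − ε/(1−ε) is a positive integer. Then the mean of the Water-Filling distribution satisfies ∑_{t=1}^∞ t·q_t = 1/(2q̄) + 1/2 + q̄·ε/(2(1−ε)²). -/
/-- The Water-Filling distribution: `q_t = q̄` for `1 ≤ t ≤ t* - 1`, and
`q_t = (1 - (t* - 1) q̄) (1 - ε) ε^(t - t*)` for `t ≥ t*`. -/
noncomputable def wfDist (ε qbar : ℝ) (tstar : ℕ) (t : ℕ) : ℝ :=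
  if t < tstar then qbar
  else (1 - ((tstar : ℝ) - 1) * qbar) * (1 - ε) * ε ^ (t - tstar)

theorem hasSum_add_one_mul_wfDist {ε : ℝ} (hε0 : 0 ≤ ε) (hε1 : ε < 1) (qbar : ℝ) (n : ℕ) :
    HasSum (fun t : ℕ => ((t : ℝ) + 1) * wfDist ε qbar (n + 1) (t + 1))
      ((1 - n * qbar) * (n + 1 + ε / (1 - ε)) + qbar * (n * (n + 1) / 2)) := by
  have hε : 1 - ε ≠ 0 := (sub_pos.2 hε1).ne'
  have head : ∑ t ∈ Finset.range n, ((t : ℝ) + 1) * wfDist ε qbar (n + 1) (t + 1) =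
      qbar * (n * (n + 1) / 2) := by
    have gauss : ∀ m : ℕ, ∑ t ∈ Finset.range m, ((t : ℝ) + 1) * qbar =
        qbar * (m * (m + 1) / 2) := by
      intro m
      induction m with
      | zero => simp
      | succ m ih => rw [Finset.sum_range_succ, ih]; push_cast; ring
    rw [← gauss n]
    refine Finset.sum_congr rfl fun t ht => ?_
    simp [wfDist, Finset.mem_range.1 ht]
  rw [← head, ← hasSum_nat_add_iff]
  have hnorm : ‖ε‖ < 1 := by rwa [Real.norm_of_nonneg hε0]
  have tail := ((hasSum_coe_mul_geometric_of_norm_lt_one hnorm).add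
    ((hasSum_geometric_of_lt_one hε0 hε1).mul_left ((n : ℝ) + 1))).mul_left
      ((1 - n * qbar) * (1 - ε))
  convert! tail using 1
  · funext t
    have h : t + n + 1 - (n + 1) = t := by omega
    have h' : ¬ t + n + 1 < n + 1 := by omega
    simp only [wfDist, h, if_neg h']
    push_cast
    ring
  · field_simp
    ring

/-- Lemma C.1 (lem:twf): the mean of the Water-Filling distribution equals
`1/(2q̄) + 1/2 + q̄ ε / (2 (1-ε)²)`. -/
theorem stmt_2 (ε qbar : ℝ) (hε0 : 0 ≤ ε) (hε1 : ε < 1)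
    (hq0 : 0 < qbar) (hq1 : qbar ≤ 1) (tstar : ℕ) (htpos : 1 ≤ tstar)
    (htdef : (tstar : ℝ) = 1 / qbar - ε / (1 - ε)) :
    ∑' t : ℕ, ((t : ℝ) + 1) * wfDist ε qbar tstar (t + 1) =
      1 / (2 * qbar) + 1 / 2 + qbar * ε / (2 * (1 - ε) ^ 2) := by
  obtain ⟨n, rfl⟩ := Nat.exists_eq_add_of_le' htpos
  rw [(hasSum_add_one_mul_wfDist hε0 hε1 qbar n).tsum_eq]
  have hε : 1 - ε ≠ 0 := (sub_pos.2 hε1).ne'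
  have hn : (n : ℝ) = 1 / qbar - ε / (1 - ε) - 1 := by
    push_cast at htdef
    linarith
  rw [hn]
  field_simp
  ring
end

section
/- Fix ε ∈ [0,1) and a real number w with w > ε/(2(1−ε)²) + 1. Set x := ε / ( (w − 1/2)² (1−ε)² ), α := ε / ( (2w−1)(1−ε)² ), and β := ε² / ( 2 (w − 1/2)³ (1−ε)⁴ ). Then: (i) 0 ≤ x < 1; (ii) the number q̄(w) := 1 / [ (w − 1/2)(1 + √(1−x)) ] satisfies the delay equation 1/(2·q̄(w)) + 1/2 + q̄(w)·ε/(2(1−ε)²) = w; and (iii) q̄(w) is sandwiched as 1/(2w − 1 − α) ≤ q̄(w) ≤ 1/(2w − 1 − α − β), where all three denominators 2w−1−α, 2w−1−α−β, and (w−1/2)(1+√(1−x)) are strictly positive. -/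
theorem Real.sqrt_one_sub_le_one_sub_half {x : ℝ} (hx : x ≤ 1) :
    Real.sqrt (1 - x) ≤ 1 - x / 2 := by
  rw [Real.sqrt_le_left (by linarith)]
  nlinarith [sq_nonneg x]

theorem Real.one_sub_half_sub_sq_half_le_sqrt_one_sub {x : ℝ} (hx0 : 0 ≤ x) (hx1 : x ≤ 1) :
    1 - x / 2 - x ^ 2 / 2 ≤ Real.sqrt (1 - x) := by
  have hs := Real.sq_sqrt (sub_nonneg.2 hx1)
  have hs0 := Real.sqrt_nonneg (1 - x)
  have hle := Real.sqrt_one_sub_le_one_sub_half hx1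
  have hmul : Real.sqrt (1 - x) * (1 + x / 2) ≤ 1 := by
    nlinarith [mul_le_mul_of_nonneg_right hle (by linarith : 0 ≤ 1 + x / 2), sq_nonneg x]
  nlinarith [mul_le_mul_of_nonneg_left hmul hs0]

/-- Eqs. (eq:barq_derive), (eqn:qbar), (eqn:qbar-): for `ε ∈ [0,1)` and
`w > ε/(2(1-ε)²) + 1`, with `x = ε/((w-1/2)²(1-ε)²)`, `α = ε/((2w-1)(1-ε)²)` and
`β = ε²/(2(w-1/2)³(1-ε)⁴)`, the quantity `q̄(w) = 1/((w-1/2)(1+√(1-x)))` satisfies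
`0 ≤ x < 1`, the delay equation `1/(2q̄) + 1/2 + q̄ε/(2(1-ε)²) = w`, and the sandwich
`1/(2w-1-α) ≤ q̄(w) ≤ 1/(2w-1-α-β)` with all denominators positive. -/
theorem stmt_10 (ε w x α β qb : ℝ) (hε0 : 0 ≤ ε) (hε1 : ε < 1)
    (hw : ε / (2 * (1 - ε) ^ 2) + 1 < w)
    (hx : x = ε / ((w - 1 / 2) ^ 2 * (1 - ε) ^ 2))
    (hα : α = ε / ((2 * w - 1) * (1 - ε) ^ 2))
    (hβ : β = ε ^ 2 / (2 * (w - 1 / 2) ^ 3 * (1 - ε) ^ 4))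
    (hqb : qb = 1 / ((w - 1 / 2) * (1 + Real.sqrt (1 - x)))) :
    (0 ≤ x ∧ x < 1) ∧
    (1 / (2 * qb) + 1 / 2 + qb * ε / (2 * (1 - ε) ^ 2) = w) ∧
    (0 < 2 * w - 1 - α ∧ 0 < 2 * w - 1 - α - β ∧
      0 < (w - 1 / 2) * (1 + Real.sqrt (1 - x))) ∧
    (1 / (2 * w - 1 - α) ≤ qb ∧ qb ≤ 1 / (2 * w - 1 - α - β)) := by
  have he : 0 < 1 - ε := by linarith
  obtain ⟨c, hc⟩ : ∃ c, c = ε / (1 - ε) ^ 2 := ⟨_, rfl⟩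
  obtain ⟨v, hv⟩ : ∃ v, v = w - 1 / 2 := ⟨_, rfl⟩
  have hc0 : 0 ≤ c := hc ▸ by positivity
  have hcv : c / 2 + 1 / 2 < v := by
    have : ε / (2 * (1 - ε) ^ 2) = c / 2 := by rw [hc]; field_simp
    linarith
  have hv0 : 0 < v := by linarith
  have hw2 : 2 * w - 1 = 2 * v := by linarith
  have hxc : x = c / v ^ 2 := by rw [hx, hc, ← hv]; field_simp
  have hcx : c = v ^ 2 * x := by rw [hxc]; field_simp
  have hx0 : 0 ≤ x := hxc ▸ by positivity
  have hx1 : x < 1 := by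
    rw [hxc, div_lt_one (by positivity)]
    nlinarith [sq_nonneg (c - 1)]
  have hαx : α = v * x / 2 := by
    rw [hα, hw2, hxc, hc]; field_simp
  have hβx : β = v * x ^ 2 / 2 := by
    rw [hβ, ← hv, hxc, hc]; field_simp
  have hs := Real.sq_sqrt (sub_nonneg.2 hx1.le)
  have hs0 := Real.sqrt_nonneg (1 - x)
  have hub := Real.sqrt_one_sub_le_one_sub_half hx1.le
  have hlb := Real.one_sub_half_sub_sq_half_le_sqrt_one_sub hx0 hx1.le
  rw [← hv] at hqb ⊢
  rw [hw2]
  generalize Real.sqrt (1 - x) = s at *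
  have hD : 0 < v * (1 + s) := by positivity
  have hαβ : 0 < 2 * v - α - β := by
    have : 2 * v - α - β = v * (2 - x / 2 - x ^ 2 / 2) := by rw [hαx, hβx]; ring
    rw [this]
    exact mul_pos hv0 (by nlinarith)
  have hβ0 : 0 ≤ β := hβx ▸ by positivity
  refine ⟨⟨hx0, hx1⟩, ?_, ⟨by linarith, hαβ, hD⟩, ?_, ?_⟩
  · have hqc : qb * ε / (2 * (1 - ε) ^ 2) = qb * c / 2 := by rw [hc]; field_simp
    have hqs : qb * c = v * (1 - s) := by
      rw [hqb, hcx, one_div_mul_eq_div, div_eq_iff hD.ne']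
      linear_combination v ^ 2 * hs
    have hq2 : 1 / (2 * qb) = v * (1 + s) / 2 := by rw [hqb]; field_simp
    rw [hqc, hqs, hq2]
    linarith
  · rw [hqb]
    apply one_div_le_one_div_of_le hD
    rw [hαx]
    nlinarith [mul_le_mul_of_nonneg_left hub hv0.le]
  · rw [hqb]
    apply one_div_le_one_div_of_le hαβ
    rw [hαx, hβx]
    nlinarith [mul_le_mul_of_nonneg_left hlb hv0.le]
end

section
/- Let q̄ ∈ (0,1] be such that m := 1/q̄ is a positive integer, and let Y be a random variable taking values in the positive integers with finite expectation such that P(Y = t) ≤ q̄ for every t ≥ 1. Then E[Y] ≥ 1/(2q̄) + 1/2. -/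
open MeasureTheory

/-- A positive integer `y` dominates `m` minus the deficit `j = m - y`, when that deficit is
nonnegative. -/
lemma natCast_sub_sum_indicator_le (m y : ℕ) (hy : 1 ≤ y) :
    (m : ℝ) - ∑ j ∈ Finset.range m, (if y = m - j then (j : ℝ) else 0) ≤ y := by
  rcases le_total y m with h | h
  · have hmem : m - y ∈ Finset.range m := Finset.mem_range.2 (by omega)
    have hle := Finset.single_le_sum
      (f := fun j : ℕ => if y = m - j then (j : ℝ) else 0)
      (fun j _ => by split_ifs <;> positivity) hmem
    have hsub : y = m - (m - y) := by omega
    simp only [if_pos hsub, Nat.cast_sub h] at hle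
    linarith
  · have hnonneg : 0 ≤ ∑ j ∈ Finset.range m, (if y = m - j then (j : ℝ) else 0) :=
      Finset.sum_nonneg fun j _ => by split_ifs <;> positivity
    have hcast : (m : ℝ) ≤ y := by exact_mod_cast h
    linarith

/-- If no value of a positive-integer-valued random variable has mass above `q`, its mean is at
least `m - q * (m * (m - 1) / 2)` for every `m`. -/
lemma sub_mul_le_integral_of_measure_eq_le {Ω : Type*} [MeasurableSpace Ω] (μ : Measure Ω)
    [IsProbabilityMeasure μ] (q : ℝ) (m : ℕ) (Y : Ω → ℕ) (hY : Measurable Y)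
    (hpos : ∀ ω, 1 ≤ Y ω) (hint : Integrable (fun ω => (Y ω : ℝ)) μ)
    (hcap : ∀ t : ℕ, 1 ≤ t → (μ {ω | Y ω = t}).toReal ≤ q) :
    (m : ℝ) - q * (m * (m - 1) / 2) ≤ ∫ ω, (Y ω : ℝ) ∂μ := by
  have hmeas (t : ℕ) : MeasurableSet {ω | Y ω = t} := hY (measurableSet_singleton t)
  have hind (j : ℕ) : (fun ω => if Y ω = m - j then (j : ℝ) else 0)
      = {ω | Y ω = m - j}.indicator fun _ => (j : ℝ) := by
    ext ω
    simp [Set.indicator_apply]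
  have hindint (j : ℕ) : Integrable (fun ω => if Y ω = m - j then (j : ℝ) else 0) μ := by
    rw [hind]
    exact (integrable_const _).indicator (hmeas _)
  have hsumint : Integrable
      (fun ω => ∑ j ∈ Finset.range m, if Y ω = m - j then (j : ℝ) else 0) μ :=
    integrable_finsetSum _ fun j _ => hindint j
  have hgauss : ∑ j ∈ Finset.range m, (j : ℝ) = m * (m - 1) / 2 := by
    have h := Finset.sum_range_id_mul_two m
    rcases Nat.eq_zero_or_pos m with rfl | hm
    · simp
    · have hcast : ((∑ j ∈ Finset.range m, j : ℕ) : ℝ) * 2 = m * ((m - 1 : ℕ) : ℝ) := by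
        exact_mod_cast h
      rw [Nat.cast_sub hm] at hcast
      push_cast at hcast
      linarith
  have hsum : ∫ ω, ∑ j ∈ Finset.range m, (if Y ω = m - j then (j : ℝ) else 0) ∂μ
      ≤ q * (m * (m - 1) / 2) := by
    rw [integral_finsetSum _ fun j _ => hindint j, ← hgauss, Finset.mul_sum]
    refine Finset.sum_le_sum fun j hj => ?_
    rw [hind, integral_indicator_const _ (hmeas _), smul_eq_mul]
    have hj' : 1 ≤ m - j := by have := Finset.mem_range.1 hj; omega
    exact mul_le_mul_of_nonneg_right (hcap _ hj') j.cast_nonneg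
  have hmono := integral_mono ((integrable_const (m : ℝ)).sub hsumint) hint
    fun ω => natCast_sub_sum_indicator_le m (Y ω) (hpos ω)
  simp only [Pi.sub_apply] at hmono
  rw [integral_sub (integrable_const _) hsumint] at hmono
  simp only [integral_const, probReal_univ, one_smul] at hmono
  linarith

/-- Noiseless special case of Lemma D.7: if a positive-integer-valued random variable `Y`
with finite mean satisfies `P(Y = t) ≤ q̄` for all `t ≥ 1`, where `1/q̄` is a positive
integer, then `E[Y] ≥ 1/(2q̄) + 1/2`. -/
theorem stmt_14 {Ω : Type*} [MeasurableSpace Ω] (μ : Measure Ω) [IsProbabilityMeasure μ]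
    (qbar : ℝ) (hq0 : 0 < qbar) (hq1 : qbar ≤ 1)
    (m : ℕ) (hm : 1 ≤ m) (hmq : (m : ℝ) = 1 / qbar)
    (Y : Ω → ℕ) (hY : Measurable Y) (hpos : ∀ ω, 1 ≤ Y ω)
    (hint : Integrable (fun ω => (Y ω : ℝ)) μ)
    (hcap : ∀ t : ℕ, 1 ≤ t → (μ {ω | Y ω = t}).toReal ≤ qbar) :
    1 / (2 * qbar) + 1 / 2 ≤ ∫ ω, (Y ω : ℝ) ∂μ := by
  have h := sub_mul_le_integral_of_measure_eq_le μ qbar m Y hY hpos hint hcap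
  rw [hmq] at h
  convert h using 1
  field_simp
  ring
end
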